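/- Let n = 4 and define, for u : U → ℂ⁴ analytic, F₁(u) := (4·I₀(u) − 3·I₄(u)²)/(10·I₃(u) + 3·I₄(u)²), F₂(u) := (50·I₂(u) + 15·I₃(u)·I₄(u) + 3·I₄(u)³)² / (10·I₃(u) + 3·I₄(u)²)³, and F₃(u) := (4000·I₁(u) + 400·I₂(u)·I₄(u) + 60·I₃(u)·I₄(u)² + 9·I₄(u)⁴) / (10·I₃(u) + 3·I₄(u)²)². Let q : V → ℂ⁴ be analytic on an open set V ⊆ ℂ and let φ(z) = (az+b)/(cz+d) be a Möbius transformation (ad − bc ≠ 0). Then F₁, F₂ and F₃ are Möbius-commuting: for every z ∈ ℂ with cz + d ≠ 0, φ(z) ∈ V, Δ(q)(φ(z)) ≠ 0, and with 10·I₃(q∘φ)(z) + 3·I₄(q∘φ)(z)² ≠ 0 and 10·I₃(q)(φ(z)) + 3·I₄(q)(φ(z))² ≠ 0, one has F_j(q ∘ φ)(z) = F_j(q)(φ(z)) for j = 1, 2, 3. -/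

import Mathlib

/-- `D(u)(z)`: the `n×n` matrix whose columns are `u'(z), u''(z), …, u⁽ⁿ⁾(z)`. -/
noncomputable def Dmat (n : ℕ) (u : ℂ → (Fin n → ℂ)) (z : ℂ) : Matrix (Fin n) (Fin n) ℂ :=
  Matrix.of fun (i j : Fin n) => iteratedDeriv (j.1 + 1) u z i

/-- `Δ(u)(z) := det D(u)(z)`. -/
noncomputable def Δmat (n : ℕ) (u : ℂ → (Fin n → ℂ)) (z : ℂ) : ℂ :=
  (Dmat n u z).det

/-- `A_i(u)(z)`: the determinant obtained from `Δ(u)(z)` by replacing the column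
`u⁽ⁱ⁾(z)` with `u⁽ⁿ⁺¹⁾(z)` (the index `i : Fin n` encodes `i+1 ∈ {1,…,n}`). -/
noncomputable def Ainv (n : ℕ) (u : ℂ → (Fin n → ℂ)) (i : Fin n) (z : ℂ) : ℂ :=
  (Matrix.of fun (r j : Fin n) =>
    if j = i then iteratedDeriv (n + 1) u z r else iteratedDeriv (j.1 + 1) u z r).det

/-- `I_i(u)(z) := A_i(u)(z)/Δ(u)(z)` (the index `i : Fin n` encodes `i+1 ∈ {1,…,n}`). -/
noncomputable def Iinv (n : ℕ) (u : ℂ → (Fin n → ℂ)) (i : Fin n) (z : ℂ) : ℂ :=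
  Ainv n u i z / Δmat n u z

/-- `I_0(u)(z) := det[u'(z), …, u⁽ⁿ⁻¹⁾(z), u⁽ⁿ⁺²⁾(z)] / Δ(u)(z)`. -/
noncomputable def I0inv (n : ℕ) (u : ℂ → (Fin n → ℂ)) (z : ℂ) : ℂ :=
  (Matrix.of fun (r j : Fin n) =>
    if j.1 = n - 1 then iteratedDeriv (n + 2) u z r else iteratedDeriv (j.1 + 1) u z r).det /
    Δmat n u z

/-- `F₁` for `n = 4`: `(4·I₀ − 3·I₄²)/(10·I₃ + 3·I₄²)`. -/
noncomputable def F1n4 (q : ℂ → (Fin 4 → ℂ)) (z : ℂ) : ℂ :=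
  (4 * I0inv 4 q z - 3 * (Iinv 4 q 3 z) ^ 2) / (10 * Iinv 4 q 2 z + 3 * (Iinv 4 q 3 z) ^ 2)

/-- `F₂` for `n = 4`: `(50·I₂ + 15·I₃·I₄ + 3·I₄³)²/(10·I₃ + 3·I₄²)³`. -/
noncomputable def F2n4 (q : ℂ → (Fin 4 → ℂ)) (z : ℂ) : ℂ :=
  (50 * Iinv 4 q 1 z + 15 * Iinv 4 q 2 z * Iinv 4 q 3 z + 3 * (Iinv 4 q 3 z) ^ 3) ^ 2 /
    (10 * Iinv 4 q 2 z + 3 * (Iinv 4 q 3 z) ^ 2) ^ 3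

/-- `F₃` for `n = 4`: `(4000·I₁ + 400·I₂·I₄ + 60·I₃·I₄² + 9·I₄⁴)/(10·I₃ + 3·I₄²)²`. -/
noncomputable def F3n4 (q : ℂ → (Fin 4 → ℂ)) (z : ℂ) : ℂ :=
  (4000 * Iinv 4 q 0 z + 400 * Iinv 4 q 1 z * Iinv 4 q 3 z +
      60 * Iinv 4 q 2 z * (Iinv 4 q 3 z) ^ 2 + 9 * (Iinv 4 q 3 z) ^ 4) /
    (10 * Iinv 4 q 2 z + 3 * (Iinv 4 q 3 z) ^ 2) ^ 2

/-- The coefficient of `w ^ (k + j) • q⁽ʲ⁾ ∘ φ` in `(q ∘ φ)⁽ᵏ⁾`, where `φ` is a Möbius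
transformation of determinant `D` with denominator `c * z + d` and `w = (c * z + d)⁻¹`. -/
def moebiusCoeff (c D : ℂ) : ℕ → ℕ → ℂ
  | 0, 0 => 1
  | 0, _ + 1 => 0
  | k + 1, 0 => -(c * k) * moebiusCoeff c D k 0
  | k + 1, j + 1 => D * moebiusCoeff c D k j - c * (k + (j + 1)) * moebiusCoeff c D k (j + 1)

theorem moebiusCoeff_eq_zero (c D : ℂ) (k j : ℕ) (hkj : k < j) : moebiusCoeff c D k j = 0 := by
  induction k generalizing j with
  | zero =>
    cases j with
    | zero => omega
    | succ j => rfl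
  | succ k ih =>
    cases j with
    | zero => omega
    | succ j => simp [moebiusCoeff, ih j (by omega), ih (j + 1) (by omega)]

theorem hasDerivAt_moebius (a b c d z : ℂ) (hz : c * z + d ≠ 0) :
    HasDerivAt (fun z => (a * z + b) / (c * z + d))
      ((a * d - b * c) * (c * z + d)⁻¹ ^ 2) z := by
  have h₁ : HasDerivAt (fun z => a * z + b) a z := by
    simpa using ((hasDerivAt_id z).const_mul a).add_const b
  have h₂ : HasDerivAt (fun z => c * z + d) c z := by
    simpa using ((hasDerivAt_id z).const_mul c).add_const d
  refine (h₁.fun_div h₂ hz).congr_deriv ?_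
  field_simp
  ring

theorem hasDerivAt_inv_linear_pow (c d z : ℂ) (hz : c * z + d ≠ 0) (n : ℕ) :
    HasDerivAt (fun z => (c * z + d)⁻¹ ^ n) (-(c * n) * (c * z + d)⁻¹ ^ (n + 1)) z := by
  have h₂ : HasDerivAt (fun z => c * z + d) c z := by
    simpa using ((hasDerivAt_id z).const_mul c).add_const d
  refine ((h₂.fun_inv hz).fun_pow n).congr_deriv ?_
  cases n with
  | zero => simp
  | succ n =>
    rw [div_eq_mul_inv, ← inv_pow, Nat.add_sub_cancel]
    ring

theorem iteratedDeriv_comp_moebius {E : Type*} [NormedAddCommGroup E] [NormedSpace ℂ E]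
    [CompleteSpace E] {V : Set ℂ} (hV : IsOpen V) {q : ℂ → E} (hq : ∀ w ∈ V, AnalyticAt ℂ q w)
    (a b c d : ℂ) {φ : ℂ → ℂ} (hφ : ∀ z, φ z = (a * z + b) / (c * z + d)) (k : ℕ) (z : ℂ)
    (hz : c * z + d ≠ 0) (hzV : φ z ∈ V) :
    iteratedDeriv k (q ∘ φ) z = ∑ j ∈ Finset.range (k + 1),
      (moebiusCoeff c (a * d - b * c) k j * (c * z + d)⁻¹ ^ (k + j)) •
        iteratedDeriv j q (φ z) := by
  obtain rfl : φ = fun z => (a * z + b) / (c * z + d) := funext hφ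
  induction k generalizing z with
  | zero => simp [moebiusCoeff]
  | succ k ih =>
    have hφz := hasDerivAt_moebius a b c d z hz
    have hev : iteratedDeriv k (q ∘ fun z => (a * z + b) / (c * z + d)) =ᶠ[nhds z] fun z =>
        ∑ j ∈ Finset.range (k + 1),
          (moebiusCoeff c (a * d - b * c) k j * (c * z + d)⁻¹ ^ (k + j)) •
            iteratedDeriv j q ((a * z + b) / (c * z + d)) := by
      have hne : ∀ᶠ y in nhds z, c * y + d ≠ 0 :=
        ContinuousAt.eventually_ne (by fun_prop) hz
      filter_upwards [hne, hφz.continuousAt.eventually (hV.mem_nhds hzV)] with y hy hyV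
      exact ih y hy hyV
    rw [iteratedDeriv_succ, hev.deriv_eq]
    have hterm : ∀ j ∈ Finset.range (k + 1), HasDerivAt (fun z =>
        (moebiusCoeff c (a * d - b * c) k j * (c * z + d)⁻¹ ^ (k + j)) •
            iteratedDeriv j q ((a * z + b) / (c * z + d)))
        ((-(c * (k + j)) * moebiusCoeff c (a * d - b * c) k j * (c * z + d)⁻¹ ^ (k + 1 + j)) •
            iteratedDeriv j q ((a * z + b) / (c * z + d)) +
          ((a * d - b * c) * moebiusCoeff c (a * d - b * c) k j *
            (c * z + d)⁻¹ ^ (k + 1 + (j + 1))) •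
            iteratedDeriv (j + 1) q ((a * z + b) / (c * z + d))) z := by
      intro j _
      have hqj : HasDerivAt (iteratedDeriv j q)
          (iteratedDeriv (j + 1) q ((a * z + b) / (c * z + d))) ((a * z + b) / (c * z + d)) := by
        rw [iteratedDeriv_succ, iteratedDeriv_eq_iterate]
        exact ((hq _ hzV).iterated_deriv j).differentiableAt.hasDerivAt
      have hw := (hasDerivAt_inv_linear_pow c d z hz (k + j)).const_mul
        (moebiusCoeff c (a * d - b * c) k j)
      refine (hw.fun_smul (hqj.scomp z hφz)).congr_deriv ?_
      rw [smul_smul, add_comm]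
      congr 2
      · push_cast
        ring
      · ring
    rw [(HasDerivAt.fun_sum hterm).deriv, Finset.sum_add_distrib, Finset.sum_range_succ' _ (k + 1)]
    have hlast := Finset.sum_range_succ (fun j : ℕ => (-(c * (k + j)) *
      moebiusCoeff c (a * d - b * c) k j * (c * z + d)⁻¹ ^ (k + 1 + j)) •
        iteratedDeriv j q ((a * z + b) / (c * z + d))) (k + 1)
    rw [moebiusCoeff_eq_zero c _ k (k + 1) (by omega)] at hlast
    simp only [mul_zero, zero_mul, zero_smul, add_zero] at hlast
    rw [← hlast, Finset.sum_range_succ', add_right_comm, ← Finset.sum_add_distrib]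
    congr 1
    · refine Finset.sum_congr rfl fun j _ => ?_
      rw [← add_smul, moebiusCoeff]
      congr 1
      push_cast
      ring
    · simp [moebiusCoeff]

theorem cramer_mulVec_eq_det_smul {n R : Type*} [Fintype n] [DecidableEq n] [CommRing R]
    (A : Matrix n n R) (x : n → R) : A.cramer (A.mulVec x) = A.det • x := by
  rw [Matrix.cramer_eq_adjugate_mulVec, Matrix.mulVec_mulVec, Matrix.adjugate_mul,
    Matrix.smul_mulVec, Matrix.one_mulVec]

theorem Iinv_eq_cramer (n : ℕ) (u : ℂ → (Fin n → ℂ)) (i : Fin n) (z : ℂ) :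
    Iinv n u i z = (Dmat n u z).cramer (iteratedDeriv (n + 1) u z) i / (Dmat n u z).det := by
  rw [Iinv, Ainv, Δmat, Matrix.cramer_apply]
  congr 2
  ext r j
  simp [Matrix.updateCol_apply, Dmat]

theorem I0inv_eq_cramer (n : ℕ) (u : ℂ → (Fin (n + 1) → ℂ)) (z : ℂ) :
    I0inv (n + 1) u z = (Dmat (n + 1) u z).cramer (iteratedDeriv (n + 3) u z) (Fin.last n) /
      (Dmat (n + 1) u z).det := by
  rw [I0inv, Δmat, Matrix.cramer_apply]
  congr 2
  ext r j
  simp [Matrix.updateCol_apply, Dmat, Fin.ext_iff]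

theorem Dmat_four_mulVec (u : ℂ → (Fin 4 → ℂ)) (z : ℂ) (x : Fin 4 → ℂ) :
    (Dmat 4 u z).mulVec x = x 0 • iteratedDeriv 1 u z + x 1 • iteratedDeriv 2 u z +
      x 2 • iteratedDeriv 3 u z + x 3 • iteratedDeriv 4 u z := by
  ext r
  simp [Matrix.mulVec, dotProduct, Fin.sum_univ_four, Dmat, mul_comm]

theorem Iinv_four_eq {u : ℂ → (Fin 4 → ℂ)} {z : ℂ} (hΔ : Δmat 4 u z ≠ 0) {x : Fin 4 → ℂ}
    (hx : iteratedDeriv 5 u z = x 0 • iteratedDeriv 1 u z + x 1 • iteratedDeriv 2 u z +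
      x 2 • iteratedDeriv 3 u z + x 3 • iteratedDeriv 4 u z) (i : Fin 4) :
    Iinv 4 u i z = x i := by
  have hΔ' : (Dmat 4 u z).det ≠ 0 := hΔ
  rw [Iinv_eq_cramer, hx, ← Dmat_four_mulVec, cramer_mulVec_eq_det_smul]
  simp [hΔ']

theorem I0inv_four_eq {u : ℂ → (Fin 4 → ℂ)} {z : ℂ} (hΔ : Δmat 4 u z ≠ 0) {x : Fin 4 → ℂ}
    (hx : iteratedDeriv 6 u z = x 0 • iteratedDeriv 1 u z + x 1 • iteratedDeriv 2 u z +
      x 2 • iteratedDeriv 3 u z + x 3 • iteratedDeriv 4 u z) :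
    I0inv 4 u z = x 3 := by
  have hΔ' : (Dmat 4 u z).det ≠ 0 := hΔ
  rw [I0inv_eq_cramer, hx, ← Dmat_four_mulVec, cramer_mulVec_eq_det_smul]
  simp [hΔ', Fin.last]

theorem exists_eq_linear_combination_of_Δmat_four_ne_zero {u : ℂ → (Fin 4 → ℂ)} {z : ℂ}
    (hΔ : Δmat 4 u z ≠ 0) (v : Fin 4 → ℂ) : ∃ x : Fin 4 → ℂ,
      v = x 0 • iteratedDeriv 1 u z + x 1 • iteratedDeriv 2 u z +
        x 2 • iteratedDeriv 3 u z + x 3 • iteratedDeriv 4 u z := by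
  have hu : IsUnit (Dmat 4 u z).det := isUnit_iff_ne_zero.mpr hΔ
  refine ⟨(Dmat 4 u z)⁻¹.mulVec v, ?_⟩
  rw [← Dmat_four_mulVec, Matrix.mulVec_mulVec, Matrix.mul_nonsing_inv _ hu, Matrix.one_mulVec]

/-- The coordinates, in terms of the derivatives of `q ∘ φ`, of the vector
`∑ j, (l ^ (j + 1) * ρ j) • q⁽ʲ⁺¹⁾ (φ z)`, with `l = φ'(z)` and `m = -c / (c * z + d)`. -/
def moebiusCoord (m : ℂ) (ρ : Fin 4 → ℂ) : Fin 4 → ℂ :=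
  ![ρ 0 - 2 * m * ρ 1 + 6 * m ^ 2 * ρ 2 - 24 * m ^ 3 * ρ 3,
    ρ 1 - 6 * m * ρ 2 + 36 * m ^ 2 * ρ 3,
    ρ 2 - 12 * m * ρ 3,
    ρ 3]

/-- The transformation of `I₀, …, I₄` under a Möbius transformation: with `w = (c * z + d)⁻¹`,
`l = φ'(z) = (a * d - b * c) * w ^ 2` and `m = -c * w`. -/
theorem invariants_comp_moebius {V : Set ℂ} (hV : IsOpen V)
    {q : ℂ → (Fin 4 → ℂ)} (hq : ∀ w ∈ V, AnalyticAt ℂ q w) (a b c d : ℂ)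
    {φ : ℂ → ℂ} (hφ : ∀ z, φ z = (a * z + b) / (c * z + d)) {z : ℂ} (hz : c * z + d ≠ 0)
    (hzV : φ z ∈ V) (hΔ : Δmat 4 q (φ z) ≠ 0) (hΔ' : Δmat 4 (q ∘ φ) z ≠ 0) {l m : ℂ}
    (hl : l = (a * d - b * c) * (c * z + d)⁻¹ ^ 2) (hm : m = -c * (c * z + d)⁻¹) :
    I0inv 4 (q ∘ φ) z =
        l ^ 2 * I0inv 4 q (φ z) + 30 * m * l * Iinv 4 q 3 (φ z) + 300 * m ^ 2 ∧
      Iinv 4 (q ∘ φ) 3 z = l * Iinv 4 q 3 (φ z) + 20 * m ∧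
      Iinv 4 (q ∘ φ) 2 z =
        l ^ 2 * Iinv 4 q 2 (φ z) - 12 * m * l * Iinv 4 q 3 (φ z) - 120 * m ^ 2 ∧
      Iinv 4 (q ∘ φ) 1 z = l ^ 3 * Iinv 4 q 1 (φ z) - 6 * m * l ^ 2 * Iinv 4 q 2 (φ z) +
        36 * m ^ 2 * l * Iinv 4 q 3 (φ z) + 240 * m ^ 3 ∧
      Iinv 4 (q ∘ φ) 0 z = l ^ 4 * Iinv 4 q 0 (φ z) - 2 * m * l ^ 3 * Iinv 4 q 1 (φ z) +
        6 * m ^ 2 * l ^ 2 * Iinv 4 q 2 (φ z) - 24 * m ^ 3 * l * Iinv 4 q 3 (φ z) -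
        120 * m ^ 4 := by
  obtain ⟨x, hx⟩ := exists_eq_linear_combination_of_Δmat_four_ne_zero hΔ (iteratedDeriv 5 q (φ z))
  obtain ⟨y, hy⟩ := exists_eq_linear_combination_of_Δmat_four_ne_zero hΔ (iteratedDeriv 6 q (φ z))
  have hder := fun k => iteratedDeriv_comp_moebius hV hq a b c d hφ k z hz hzV
  have h₁ : iteratedDeriv 1 (q ∘ φ) z = l • iteratedDeriv 1 q (φ z) := by
    rw [hder, hl]
    simp [Finset.sum_range_succ, moebiusCoeff]
  have h₂ : iteratedDeriv 2 (q ∘ φ) z =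
      (2 * m * l) • iteratedDeriv 1 q (φ z) + l ^ 2 • iteratedDeriv 2 q (φ z) := by
    rw [hder, hl, hm]
    generalize (c * z + d)⁻¹ = w
    simp [Finset.sum_range_succ, moebiusCoeff]
    module
  have h₃ : iteratedDeriv 3 (q ∘ φ) z =
      (6 * m ^ 2 * l) • iteratedDeriv 1 q (φ z) + (6 * m * l ^ 2) • iteratedDeriv 2 q (φ z) +
        l ^ 3 • iteratedDeriv 3 q (φ z) := by
    rw [hder, hl, hm]
    generalize (c * z + d)⁻¹ = w
    simp [Finset.sum_range_succ, moebiusCoeff]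
    module
  have h₄ : iteratedDeriv 4 (q ∘ φ) z =
      (24 * m ^ 3 * l) • iteratedDeriv 1 q (φ z) +
        (36 * m ^ 2 * l ^ 2) • iteratedDeriv 2 q (φ z) +
        (12 * m * l ^ 3) • iteratedDeriv 3 q (φ z) + l ^ 4 • iteratedDeriv 4 q (φ z) := by
    rw [hder, hl, hm]
    generalize (c * z + d)⁻¹ = w
    simp [Finset.sum_range_succ, moebiusCoeff]
    module
  have h₅ : iteratedDeriv 5 (q ∘ φ) z =
      (120 * m ^ 4 * l) • iteratedDeriv 1 q (φ z) +
        (240 * m ^ 3 * l ^ 2) • iteratedDeriv 2 q (φ z) +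
        (120 * m ^ 2 * l ^ 3) • iteratedDeriv 3 q (φ z) +
        (20 * m * l ^ 4) • iteratedDeriv 4 q (φ z) + l ^ 5 • iteratedDeriv 5 q (φ z) := by
    rw [hder, hl, hm]
    generalize (c * z + d)⁻¹ = w
    simp [Finset.sum_range_succ, moebiusCoeff]
    module
  have h₆ : iteratedDeriv 6 (q ∘ φ) z =
      (720 * m ^ 5 * l) • iteratedDeriv 1 q (φ z) +
        (1800 * m ^ 4 * l ^ 2) • iteratedDeriv 2 q (φ z) +
        (1200 * m ^ 3 * l ^ 3) • iteratedDeriv 3 q (φ z) +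
        (300 * m ^ 2 * l ^ 4) • iteratedDeriv 4 q (φ z) +
        (30 * m * l ^ 5) • iteratedDeriv 5 q (φ z) + l ^ 6 • iteratedDeriv 6 q (φ z) := by
    rw [hder, hl, hm]
    generalize (c * z + d)⁻¹ = w
    simp [Finset.sum_range_succ, moebiusCoeff]
    module
  have hcoord : ∀ ρ : Fin 4 → ℂ, (l * ρ 0) • iteratedDeriv 1 q (φ z) +
      (l ^ 2 * ρ 1) • iteratedDeriv 2 q (φ z) + (l ^ 3 * ρ 2) • iteratedDeriv 3 q (φ z) +
      (l ^ 4 * ρ 3) • iteratedDeriv 4 q (φ z) =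
      moebiusCoord m ρ 0 • iteratedDeriv 1 (q ∘ φ) z +
        moebiusCoord m ρ 1 • iteratedDeriv 2 (q ∘ φ) z +
        moebiusCoord m ρ 2 • iteratedDeriv 3 (q ∘ φ) z +
        moebiusCoord m ρ 3 • iteratedDeriv 4 (q ∘ φ) z := by
    intro ρ
    rw [h₁, h₂, h₃, h₄]
    simp only [moebiusCoord, Matrix.cons_val]
    module
  have hI := Iinv_four_eq hΔ hx
  have hI' := Iinv_four_eq hΔ' (x := moebiusCoord m
    ![l ^ 4 * x 0 + 120 * m ^ 4, l ^ 3 * x 1 + 240 * m ^ 3, l ^ 2 * x 2 + 120 * m ^ 2,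
      l * x 3 + 20 * m]) (by
    rw [← hcoord, h₅, hx]
    simp only [Matrix.cons_val]
    module)
  have hI₀' := I0inv_four_eq hΔ' (x := moebiusCoord m
    ![l ^ 5 * y 0 + 30 * m * l ^ 4 * x 0 + 720 * m ^ 5,
      l ^ 4 * y 1 + 30 * m * l ^ 3 * x 1 + 1800 * m ^ 4,
      l ^ 3 * y 2 + 30 * m * l ^ 2 * x 2 + 1200 * m ^ 3,
      l ^ 2 * y 3 + 30 * m * l * x 3 + 300 * m ^ 2]) (by
    rw [← hcoord, h₆, hx, hy]
    simp only [Matrix.cons_val]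
    module)
  simp only [hI, hI', hI₀', I0inv_four_eq hΔ hy, moebiusCoord, Matrix.cons_val]
  refine ⟨trivial, trivial, ?_, ?_, ?_⟩ <;> ring

/-- for `n = 4`, the invariants `F₁`, `F₂` and `F₃` are
Möbius-commuting. -/
theorem F1_F2_F3_moebius_commuting_n4 (V : Set ℂ) (hV : IsOpen V)
    (q : ℂ → (Fin 4 → ℂ)) (hq : ∀ w ∈ V, AnalyticAt ℂ q w)
    (a b c d : ℂ) (h : a * d - b * c ≠ 0)
    (φ : ℂ → ℂ) (hφ : ∀ z, φ z = (a * z + b) / (c * z + d))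
    (z : ℂ) (hz : c * z + d ≠ 0) (hzV : φ z ∈ V) (hΔ : Δmat 4 q (φ z) ≠ 0)
    (hden₁ : 10 * Iinv 4 (q ∘ φ) 2 z + 3 * (Iinv 4 (q ∘ φ) 3 z) ^ 2 ≠ 0)
    (hden₂ : 10 * Iinv 4 q 2 (φ z) + 3 * (Iinv 4 q 3 (φ z)) ^ 2 ≠ 0) :
    F1n4 (q ∘ φ) z = F1n4 q (φ z) ∧ F2n4 (q ∘ φ) z = F2n4 q (φ z) ∧
      F3n4 (q ∘ φ) z = F3n4 q (φ z) := by
  have hΔ' : Δmat 4 (q ∘ φ) z ≠ 0 := fun h₀ => hden₁ (by simp [Iinv, h₀])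
  obtain ⟨l, hl⟩ : ∃ l, l = (a * d - b * c) * (c * z + d)⁻¹ ^ 2 := ⟨_, rfl⟩
  obtain ⟨m, hm⟩ : ∃ m, m = -c * (c * z + d)⁻¹ := ⟨_, rfl⟩
  obtain ⟨h₀, h₄, h₃, h₂, h₁⟩ :=
    invariants_comp_moebius hV hq a b c d hφ hz hzV hΔ hΔ' hl hm
  have hden : 10 * Iinv 4 (q ∘ φ) 2 z + 3 * Iinv 4 (q ∘ φ) 3 z ^ 2 =
      l ^ 2 * (10 * Iinv 4 q 2 (φ z) + 3 * Iinv 4 q 3 (φ z) ^ 2) := by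
    rw [h₃, h₄]
    ring
  refine ⟨?_, ?_, ?_⟩
  · rw [F1n4, F1n4, hden, div_eq_div_iff (hden ▸ hden₁) hden₂, h₀, h₄]
    ring
  · rw [F2n4, F2n4, hden, div_eq_div_iff (pow_ne_zero 3 (hden ▸ hden₁)) (pow_ne_zero 3 hden₂),
      h₂, h₃, h₄]
    ring
  · rw [F3n4, F3n4, hden, div_eq_div_iff (pow_ne_zero 2 (hden ▸ hden₁)) (pow_ne_zero 2 hden₂),
      h₁, h₂, h₃, h₄]
    ring
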